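/- Under the hypotheses of the previous statement, u(x₁, x') → u^± for almost every x' ∈ ω as x₁ → ±∞, where u^± are the same wells as in the L² convergence. -/

import Mathlib

open MeasureTheory Metric Set Filter Topology
open scoped ENNReal NNReal RealInnerProductSpace

/-- `ω ⊂ ℝ^m` has Lipschitz boundary: near each boundary point, in a suitable orthonormal
splitting of `ℝ^m` into a unit direction `u` and its orthogonal complement, `ω` is the open
hypograph/epigraph of a Lipschitz function. -/
def LipschitzBoundary {m : ℕ} (ω : Set (EuclideanSpace ℝ (Fin m))) : Prop :=
  ∀ p ∈ frontier ω, ∃ u : EuclideanSpace ℝ (Fin m), ‖u‖ = 1 ∧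
    ∃ (φ : EuclideanSpace ℝ (Fin m) → ℝ) (K : ℝ≥0) (r : ℝ), 0 < r ∧ LipschitzWith K φ ∧
      ∀ x ∈ Metric.ball p r, (x ∈ ω ↔ φ (x - ⟪x, u⟫ • u) < ⟪x, u⟫)

/-- Membership in `H¹(ω, ℝ^N)` (encoded for an everywhere-defined representative via
differentiability on `ω` together with integrability of the map and of `|∇v|²`). -/
def MemH1 {m N : ℕ} (ω : Set (EuclideanSpace ℝ (Fin m)))
    (v : EuclideanSpace ℝ (Fin m) → EuclideanSpace ℝ (Fin N)) : Prop :=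
  DifferentiableOn ℝ v ω ∧ MeasureTheory.IntegrableOn v ω ∧
    (∫⁻ x in ω, (‖fderivWithin ℝ v ω x‖₊ : ℝ≥0∞) ^ 2) < ⊤

/-- The averaged energy `e(v) = ⨍_ω (|∇v|² + W(v))`. -/
noncomputable def eAvg {m N : ℕ} (W : EuclideanSpace ℝ (Fin N) → ℝ≥0∞)
    (ω : Set (EuclideanSpace ℝ (Fin m)))
    (v : EuclideanSpace ℝ (Fin m) → EuclideanSpace ℝ (Fin N)) : ℝ≥0∞ :=
  (volume ω)⁻¹ * ∫⁻ x in ω, ((‖fderivWithin ℝ v ω x‖₊ : ℝ≥0∞) ^ 2 + W (v x))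

/-- The averaged potential
`V(z) = inf { ⨍_ω (|∇v|² + W(v)) : v ∈ H¹(ω,ℝ^N), ⨍_ω v = z }`. -/
noncomputable def Vavg {m N : ℕ} (W : EuclideanSpace ℝ (Fin N) → ℝ≥0∞)
    (ω : Set (EuclideanSpace ℝ (Fin m))) (z : EuclideanSpace ℝ (Fin N)) : ℝ≥0∞ :=
  ⨅ v ∈ {v : EuclideanSpace ℝ (Fin m) → EuclideanSpace ℝ (Fin N) |
      MemH1 ω v ∧ (⨍ x in ω, v x) = z}, eAvg W ω v


lemma lint_cs {α : Type*} [MeasurableSpace α] (μ : Measure α) (f : α → ℝ≥0∞) (hf : AEMeasurable f μ) :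
    (∫⁻ x, f x ∂μ) ^ 2 ≤ μ univ * ∫⁻ x, f x ^ 2 ∂μ := by
  have h := ENNReal.lintegral_mul_le_Lp_mul_Lq μ (Real.HolderConjugate.two_two) hf
    (aemeasurable_const (b := (1 : ℝ≥0∞)))
  simp only [Pi.mul_apply, mul_one, ENNReal.one_rpow, lintegral_const, one_mul] at h
  have h2 : ∀ x : ℝ≥0∞, (x ^ (1 / 2 : ℝ)) ^ 2 = x := by
    intro x
    rw [← ENNReal.rpow_natCast, ← ENNReal.rpow_mul]; norm_num
  calc (∫⁻ x, f x ∂μ) ^ 2 ≤ _ := pow_le_pow_left' h 2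
    _ = _ := by
      rw [mul_pow, h2, h2, mul_comm]
      congr 1
      refine lintegral_congr fun x => ?_
      exact ENNReal.rpow_natCast (f x) 2

lemma enorm_interval_sq {F : Type*} [NormedAddCommGroup F] [NormedSpace ℝ F] [MeasurableSpace F] [BorelSpace F]
    (g : ℝ → F) (hg : Measurable g) (s t : ℝ) :
    ‖∫ r in s..t, g r‖ₑ ^ 2 ≤ ENNReal.ofReal |t - s| * ∫⁻ r in uIoc s t, ‖g r‖ₑ ^ 2 := by
  have h1 : ‖∫ r in s..t, g r‖ₑ ≤ ∫⁻ r in uIoc s t, ‖g r‖ₑ := by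
    have : ‖∫ r in s..t, g r‖ₑ = ‖∫ r in uIoc s t, g r‖ₑ := by
      rw [← ofReal_norm, intervalIntegral.norm_intervalIntegral_eq, ofReal_norm]
    rw [this]
    exact enorm_integral_le_lintegral_enorm _
  refine (pow_le_pow_left' h1 2).trans ((lint_cs _ _ hg.enorm.aemeasurable).trans ?_)
  rw [Measure.restrict_apply_univ, uIoc, Real.volume_Ioc]
  rw [max_sub_min_eq_abs]

lemma enorm_sub_sq_le {F : Type*} [NormedAddCommGroup F] (a b c : F) :
    ‖a - c‖ₑ ^ 2 ≤ 2 * ‖a - b‖ₑ ^ 2 + 2 * ‖b - c‖ₑ ^ 2 := by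
  have h : ‖a - c‖ ^ 2 ≤ 2 * ‖a - b‖ ^ 2 + 2 * ‖b - c‖ ^ 2 := by
    have := norm_sub_le_norm_sub_add_norm_sub a b c
    nlinarith [norm_nonneg (a - c), sq_nonneg (‖a-b‖ - ‖b-c‖)]
  simp only [← ofReal_norm]
  rw [← ENNReal.ofReal_pow (norm_nonneg _), ← ENNReal.ofReal_pow (norm_nonneg _),
    ← ENNReal.ofReal_pow (norm_nonneg _)]
  rw [show (2 : ℝ≥0∞) = ENNReal.ofReal 2 by simp, ← ENNReal.ofReal_mul (by norm_num),
    ← ENNReal.ofReal_mul (by norm_num), ← ENNReal.ofReal_add (by positivity) (by positivity)]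
  exact ENNReal.ofReal_le_ofReal h

lemma slide_pt {m N : ℕ} {ω : Set (EuclideanSpace ℝ (Fin m))} (hωo : IsOpen ω)
    (v : EuclideanSpace ℝ (Fin m) → EuclideanSpace ℝ (Fin N)) (hv : DifferentiableOn ℝ v ω)
    (h x : EuclideanSpace ℝ (Fin m)) (hA : ∀ s ∈ Icc (0:ℝ) 1, x + s • h ∈ ω) :
    ‖v (x + h) - v x‖ₑ ^ 2 ≤ ‖h‖ₑ ^ 2 * ∫⁻ s in Ioc (0:ℝ) 1, ‖fderiv ℝ v (x + s • h)‖ₑ ^ 2 := by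
  have hmeas : Measurable fun s : ℝ => fderiv ℝ v (x + s • h) :=
    (measurable_fderiv ℝ v).comp (by fun_prop)
  have hmeas2 : Measurable fun s : ℝ => fderiv ℝ v (x + s • h) h :=
    (measurable_fderiv_apply_const ℝ v h).comp (by fun_prop)
  have hle : ∫⁻ s in Ioc (0:ℝ) 1, ‖fderiv ℝ v (x + s • h) h‖ₑ ^ 2 ≤
      ‖h‖ₑ ^ 2 * ∫⁻ s in Ioc (0:ℝ) 1, ‖fderiv ℝ v (x + s • h)‖ₑ ^ 2 := by
    rw [← lintegral_const_mul _ (by fun_prop)]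
    refine lintegral_mono fun s => ?_
    rw [← mul_pow, mul_comm]
    exact pow_le_pow_left' (ContinuousLinearMap.le_opENorm _ _) 2
  refine le_trans ?_ hle
  by_cases htop : ∫⁻ s in Ioc (0:ℝ) 1, ‖fderiv ℝ v (x + s • h) h‖ₑ ^ 2 = ⊤
  · rw [htop]; exact le_top
  have hd : ∀ s ∈ uIcc (0:ℝ) 1, HasDerivAt (fun s : ℝ => v (x + s • h)) (fderiv ℝ v (x + s • h) h) s := by
    intro s hs
    rw [uIcc_of_le zero_le_one] at hs
    have h1 : HasFDerivAt v (fderiv ℝ v (x + s • h)) (x + s • h) :=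
      ((hv _ (hA s hs)).differentiableAt (hωo.mem_nhds (hA s hs))).hasFDerivAt
    have h2 : HasDerivAt (fun s : ℝ => x + s • h) h s := by
      simpa using ((hasDerivAt_id s).smul_const h).const_add x
    exact h1.comp_hasDerivAt s h2
  have hint : IntervalIntegrable (fun s : ℝ => fderiv ℝ v (x + s • h) h) volume 0 1 := by
    rw [intervalIntegrable_iff_integrableOn_Ioc_of_le zero_le_one]
    refine ⟨hmeas2.aestronglyMeasurable, ?_⟩
    have := lint_cs (volume.restrict (Ioc (0:ℝ) 1)) _ hmeas2.enorm.aemeasurable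
    rw [Measure.restrict_apply_univ, Real.volume_Ioc] at this
    simp only [sub_zero, ENNReal.ofReal_one, one_mul] at this
    have h3 := this.trans_lt (lt_top_iff_ne_top.2 htop)
    exact (ENNReal.pow_lt_top_iff.1 h3).resolve_right (by norm_num)
  have := intervalIntegral.integral_eq_sub_of_hasDerivAt hd hint
  simp only [one_smul, zero_smul, add_zero] at this
  rw [← this]
  refine (enorm_interval_sq _ hmeas2 0 1).trans ?_
  simp [uIoc_of_le]

lemma slide {m N : ℕ} {ω : Set (EuclideanSpace ℝ (Fin m))} (hωo : IsOpen ω)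
    (v : EuclideanSpace ℝ (Fin m) → EuclideanSpace ℝ (Fin N)) (hv : DifferentiableOn ℝ v ω)
    (A : Set (EuclideanSpace ℝ (Fin m))) (hAm : MeasurableSet A)
    (h : EuclideanSpace ℝ (Fin m)) (hA : ∀ x ∈ A, ∀ s ∈ Icc (0:ℝ) 1, x + s • h ∈ ω) :
    ∫⁻ x in A, ‖v (x + h) - v x‖ₑ ^ 2 ≤ ‖h‖ₑ ^ 2 * ∫⁻ x in ω, ‖fderiv ℝ v x‖ₑ ^ 2 := by
  have hm : Measurable (Function.uncurry fun (x : EuclideanSpace ℝ (Fin m)) (s : ℝ) =>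
      ‖fderiv ℝ v (x + s • h)‖ₑ ^ 2) := by
    have : Measurable fun p : EuclideanSpace ℝ (Fin m) × ℝ => fderiv ℝ v (p.1 + p.2 • h) :=
      (measurable_fderiv ℝ v).comp (by fun_prop)
    exact this.enorm.pow_const 2
  calc ∫⁻ x in A, ‖v (x + h) - v x‖ₑ ^ 2
      ≤ ∫⁻ x in A, ‖h‖ₑ ^ 2 * ∫⁻ s in Ioc (0:ℝ) 1, ‖fderiv ℝ v (x + s • h)‖ₑ ^ 2 :=
        setLIntegral_mono' hAm fun x hx => slide_pt hωo v hv h x (hA x hx)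
    _ = ‖h‖ₑ ^ 2 * ∫⁻ x in A, ∫⁻ s in Ioc (0:ℝ) 1, ‖fderiv ℝ v (x + s • h)‖ₑ ^ 2 :=
        lintegral_const_mul' _ _ (by simp)
    _ = ‖h‖ₑ ^ 2 * ∫⁻ s in Ioc (0:ℝ) 1, ∫⁻ x in A, ‖fderiv ℝ v (x + s • h)‖ₑ ^ 2 := by
        rw [lintegral_lintegral_swap hm.aemeasurable]
    _ ≤ ‖h‖ₑ ^ 2 * ∫⁻ s in Ioc (0:ℝ) 1, ∫⁻ x in ω, ‖fderiv ℝ v x‖ₑ ^ 2 := by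
        refine mul_le_mul_right (setLIntegral_mono' measurableSet_Ioc fun s hs => ?_) _
        rw [← lintegral_indicator hAm, ← lintegral_indicator hωo.measurableSet,
          ← lintegral_add_right_eq_self (ω.indicator _) (s • h)]
        refine lintegral_mono fun x => ?_
        by_cases hx : x ∈ A
        · have : x + s • h ∈ ω := hA x hx s ⟨hs.1.le, hs.2⟩
          simp [hx, this]
        · simp [hx]
    _ = _ := by simp

def QRel {m : ℕ} (N : ℕ) (ω A B : Set (EuclideanSpace ℝ (Fin m))) : Prop :=
  ∃ C : ℝ≥0∞, C ≠ ⊤ ∧ ∀ v : EuclideanSpace ℝ (Fin m) → EuclideanSpace ℝ (Fin N),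
    Measurable v → DifferentiableOn ℝ v ω →
    ∫⁻ x in A, ∫⁻ y in B, ‖v x - v y‖ₑ ^ 2 ≤ C * ∫⁻ x in ω, ‖fderiv ℝ v x‖ₑ ^ 2

section Q
variable {m N : ℕ} {ω A A' B B' M : Set (EuclideanSpace ℝ (Fin m))}

lemma QRel.mono (h : QRel N ω A B) (hA : A' ⊆ A) (hB : B' ⊆ B) : QRel N ω A' B' := by
  obtain ⟨C, hC, h⟩ := h
  refine ⟨C, hC, fun v hv hd => le_trans ?_ (h v hv hd)⟩
  exact (lintegral_mono_set hA).trans (lintegral_mono fun x => lintegral_mono_set hB)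

lemma QRel.symm (h : QRel N ω A B) : QRel N ω B A := by
  obtain ⟨C, hC, h⟩ := h
  refine ⟨C, hC, fun v hv hd => le_trans (le_of_eq ?_) (h v hv hd)⟩
  rw [lintegral_lintegral_swap (by fun_prop)]
  refine lintegral_congr fun x => lintegral_congr fun y => ?_
  rw [← enorm_neg, neg_sub]

lemma QRel.union (h : QRel N ω A B) (h' : QRel N ω A' B) : QRel N ω (A ∪ A') B := by
  obtain ⟨C, hC, h⟩ := h
  obtain ⟨C', hC', h'⟩ := h'
  refine ⟨C + C', by simp [hC, hC'], fun v hv hd => ?_⟩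
  rw [add_mul]
  exact (lintegral_union_le _ _ _).trans (add_le_add (h v hv hd) (h' v hv hd))

lemma QRel.trans (h : QRel N ω A M) (h' : QRel N ω M B) (h0 : volume M ≠ 0) (hM : volume M ≠ ⊤)
    (hA : volume A ≠ ⊤) (hB : volume B ≠ ⊤) : QRel N ω A B := by
  obtain ⟨C, hC, h⟩ := h
  obtain ⟨C', hC', h'⟩ := h'
  refine ⟨(volume M)⁻¹ * (2 * volume B * C + 2 * volume A * C'), by finiteness, fun v hv hd => ?_⟩
  rw [mul_assoc, ← ENNReal.mul_le_iff_le_inv h0 hM]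
  have h1 : volume M * ∫⁻ x in A, ∫⁻ y in B, ‖v x - v y‖ₑ ^ 2
      = ∫⁻ z in M, ∫⁻ x in A, ∫⁻ y in B, ‖v x - v y‖ₑ ^ 2 := by
    simp [mul_comm]
  rw [h1]
  have mB : ∀ z, Measurable fun y => 2 * ‖v z - v y‖ₑ ^ 2 := fun z => by fun_prop
  calc _ ≤ ∫⁻ z in M, ∫⁻ x in A, ∫⁻ y in B, (2 * ‖v x - v z‖ₑ ^ 2 + 2 * ‖v z - v y‖ₑ ^ 2) :=
        lintegral_mono fun z => lintegral_mono fun x => lintegral_mono fun y => enorm_sub_sq_le _ _ _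
    _ = ∫⁻ z in M, ((2 * volume B * ∫⁻ x in A, ‖v x - v z‖ₑ ^ 2) +
          2 * volume A * ∫⁻ y in B, ‖v z - v y‖ₑ ^ 2) := by
        refine lintegral_congr fun z => ?_
        have : ∀ x, ∫⁻ y in B, (2 * ‖v x - v z‖ₑ ^ 2 + 2 * ‖v z - v y‖ₑ ^ 2) =
            2 * volume B * ‖v x - v z‖ₑ ^ 2 + 2 * ∫⁻ y in B, ‖v z - v y‖ₑ ^ 2 := by
          intro x
          rw [lintegral_add_right _ (mB z),
            lintegral_const_mul (f := fun y => ‖v z - v y‖ₑ ^ 2) _ (by fun_prop), setLIntegral_const]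
          ring
        simp_rw [this]
        rw [lintegral_add_right _ measurable_const, lintegral_const_mul _ (by fun_prop)]
        simp; ring
    _ = (2 * volume B * ∫⁻ z in M, ∫⁻ x in A, ‖v x - v z‖ₑ ^ 2) +
          2 * volume A * ∫⁻ z in M, ∫⁻ y in B, ‖v z - v y‖ₑ ^ 2 := by
        have e1 : Measurable fun z => ∫⁻ x in A, ‖v x - v z‖ₑ ^ 2 :=
          Measurable.lintegral_prod_right' (f := fun p : _ × _ => ‖v p.2 - v p.1‖ₑ ^ 2) (by fun_prop)
        have e2 : Measurable fun z => ∫⁻ x in B, ‖v z - v x‖ₑ ^ 2 :=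
          Measurable.lintegral_prod_right' (f := fun p : _ × _ => ‖v p.1 - v p.2‖ₑ ^ 2) (by fun_prop)
        rw [lintegral_add_left (e1.const_mul _), lintegral_const_mul _ e1, lintegral_const_mul _ e2]
    _ ≤ _ := by
        rw [lintegral_lintegral_swap (by fun_prop)]
        rw [add_mul, mul_assoc _ C, mul_assoc _ C']
        gcongr
        · exact h v hv hd
        · exact h' v hv hd

lemma QRel.base (hωo : IsOpen ω) (c : EuclideanSpace ℝ (Fin m)) (r : ℝ)
    (hb : ball c (3 * r) ⊆ ω) : QRel N ω (ball c r) (ball c r) := by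
  refine ⟨ENNReal.ofReal (2 * r) ^ 2 * volume (ball (0 : EuclideanSpace ℝ (Fin m)) (2 * r)),
    ?_, fun v hv hd => ?_⟩
  · have : volume (ball (0 : EuclideanSpace ℝ (Fin m)) (2 * r)) ≠ ⊤ := measure_ball_lt_top.ne
    finiteness
  have h1 : ∀ x ∈ ball c r, ∫⁻ y in ball c r, ‖v x - v y‖ₑ ^ 2 ≤
      ∫⁻ h in ball (0 : EuclideanSpace ℝ (Fin m)) (2 * r), ‖v (x + h) - v x‖ₑ ^ 2 := by
    intro x hx
    rw [← lintegral_indicator measurableSet_ball, ← lintegral_indicator measurableSet_ball,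
      ← lintegral_add_left_eq_self ((ball c r).indicator _) x]
    refine lintegral_mono fun h => ?_
    by_cases hh : x + h ∈ ball c r
    · have : h ∈ ball (0 : EuclideanSpace ℝ (Fin m)) (2 * r) := by
        rw [mem_ball_zero_iff]
        have e : h = (x + h - c) - (x - c) := by abel
        rw [mem_ball_iff_norm] at hx hh
        calc ‖h‖ = ‖(x + h - c) - (x - c)‖ := by rw [← e]
          _ ≤ _ := norm_sub_le _ _
          _ < _ := by linarith
      rw [indicator_of_mem hh, indicator_of_mem this, ← enorm_neg, neg_sub]
    · rw [indicator_of_notMem hh]; exact zero_le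
  calc _ ≤ ∫⁻ x in ball c r, ∫⁻ h in ball (0 : EuclideanSpace ℝ (Fin m)) (2 * r),
            ‖v (x + h) - v x‖ₑ ^ 2 := setLIntegral_mono' measurableSet_ball h1
    _ = ∫⁻ h in ball (0 : EuclideanSpace ℝ (Fin m)) (2 * r), ∫⁻ x in ball c r,
            ‖v (x + h) - v x‖ₑ ^ 2 := by rw [lintegral_lintegral_swap (by fun_prop)]
    _ ≤ ∫⁻ h in ball (0 : EuclideanSpace ℝ (Fin m)) (2 * r),
          ENNReal.ofReal (2 * r) ^ 2 * ∫⁻ x in ω, ‖fderiv ℝ v x‖ₑ ^ 2 := by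
        refine setLIntegral_mono' measurableSet_ball fun h hh => ?_
        rw [mem_ball_zero_iff] at hh
        refine (slide hωo v hd _ measurableSet_ball h ?_).trans ?_
        · intro x hx s hs
          apply hb
          rw [mem_ball_iff_norm] at hx ⊢
          have : ‖s • h‖ ≤ ‖h‖ := by
            rw [norm_smul, Real.norm_of_nonneg hs.1]
            exact mul_le_of_le_one_left (norm_nonneg _) hs.2
          calc ‖x + s • h - c‖ = ‖(x - c) + s • h‖ := by congr 1; abel
            _ ≤ _ := norm_add_le _ _
            _ < _ := by linarith
        · gcongr
          rw [← ofReal_norm]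
          exact ENNReal.ofReal_le_ofReal hh.le
    _ = _ := by
        rw [setLIntegral_const]; ring
end Q

lemma poincare {m : ℕ} (N : ℕ) (ω : Set (EuclideanSpace ℝ (Fin m)))
    (hωo : IsOpen ω) (hωc : IsConnected ω) (hωb : Bornology.IsBounded ω)
    (hωl : ∀ p ∈ frontier ω, ∃ u : EuclideanSpace ℝ (Fin m), ‖u‖ = 1 ∧
    ∃ (φ : EuclideanSpace ℝ (Fin m) → ℝ) (K : ℝ≥0) (r : ℝ), 0 < r ∧ LipschitzWith K φ ∧
      ∀ x ∈ Metric.ball p r, (x ∈ ω ↔ φ (x - ⟪x, u⟫ • u) < ⟪x, u⟫)) : QRel N ω ω ω := by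
  have hfin : ∀ A ⊆ ω, volume A ≠ ⊤ := fun A hA =>
    ((measure_mono hA).trans_lt hωb.measure_lt_top).ne
  obtain ⟨x0, hx0⟩ := hωc.nonempty
  have loc : ∀ x ∈ ω, ∃ r > 0, ball x r ⊆ ω ∧ QRel N ω (ball x r) (ball x r) := by
    intro x hx
    obtain ⟨ε, hε, h⟩ := Metric.isOpen_iff.1 hωo x hx
    refine ⟨ε / 3, by positivity, (ball_subset_ball (by linarith)).trans h,
      QRel.base hωo x _ (by convert h using 2; ring)⟩
  obtain ⟨r0, hr0, hB0, hQ0⟩ := loc x0 hx0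
  set B0 := ball x0 r0
  have inner : ∀ x ∈ ω, ∃ r > 0, ball x r ⊆ ω ∧ QRel N ω (ball x r) B0 := by
    set S := {x | ∃ r > 0, ball x r ⊆ ω ∧ QRel N ω (ball x r) B0} with hS
    have hSo : IsOpen S := by
      rw [Metric.isOpen_iff]
      rintro x ⟨r, hr, h1, h2⟩
      refine ⟨r / 2, by positivity, fun y hy => ⟨r / 2, by positivity, ?_, ?_⟩⟩
      all_goals
        have : ball y (r / 2) ⊆ ball x r := by
          apply ball_subset_ball'
          rw [mem_ball] at hy; linarith
      · exact this.trans h1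
      · exact h2.mono this subset_rfl
    refine hωc.isPreconnected.subset_of_closure_inter_subset hSo ⟨x0, hx0, r0, hr0, hB0, hQ0⟩ ?_
    rintro x ⟨hxc, hx⟩
    obtain ⟨r, hr, h1, h2⟩ := loc x hx
    obtain ⟨y, hy, hyS⟩ := mem_closure_iff.1 hxc (ball x r) isOpen_ball (mem_ball_self hr)
    obtain ⟨ρ, hρ, h3, h4⟩ := hyS
    refine ⟨r, hr, h1, QRel.trans (M := ball x r ∩ ball y ρ) (h2.mono subset_rfl inter_subset_left)
      (h4.mono inter_subset_right subset_rfl) ?_ (hfin _ (inter_subset_left.trans h1)) (hfin _ h1)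
      (hfin _ hB0)⟩
    exact ((isOpen_ball.inter isOpen_ball).measure_pos _ ⟨y, hy, mem_ball_self hρ⟩).ne'
  have key : ∀ p ∈ closure ω, ∃ U ∈ 𝓝[closure ω] p, QRel N ω (U ∩ ω) B0 := by
    intro p hp
    by_cases hpω : p ∈ ω
    · obtain ⟨r, hr, h1, h2⟩ := inner p hpω
      exact ⟨ball p r, mem_nhdsWithin_of_mem_nhds (ball_mem_nhds p hr), h2.mono inter_subset_left subset_rfl⟩
    have hpf : p ∈ frontier ω := ⟨hp, by rwa [hωo.interior_eq]⟩
    obtain ⟨e, he, φ, K, r, hr, hφ, hgr⟩ := hωl p hpf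
    have hee : ⟪e, e⟫ = (1:ℝ) := by rw [real_inner_self_eq_norm_sq, he]; norm_num
    have proj : ∀ (x : EuclideanSpace ℝ (Fin m)) (s : ℝ),
        x + s • e - ⟪x + s • e, e⟫ • e = x - ⟪x, e⟫ • e ∧ ⟪x + s • e, e⟫ = ⟪x, e⟫ + s := by
      intro x s
      have : ⟪x + s • e, e⟫ = ⟪x, e⟫ + s := by
        rw [inner_add_left, real_inner_smul_left, hee, mul_one]
      refine ⟨?_, this⟩
      rw [this, add_smul]; abel
    have hple : φ (p - ⟪p, e⟫ • e) ≤ ⟪p, e⟫ := by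
      have hcl : p ∈ closure (ω ∩ ball p r) := by
        rw [mem_closure_iff_nhds] at hp ⊢
        intro t ht
        obtain ⟨z, hz⟩ := hp (t ∩ ball p r) (inter_mem ht (ball_mem_nhds p hr))
        exact ⟨z, hz.1.1, hz.2, hz.1.2⟩
      have hc : IsClosed {x | φ (x - ⟪x, e⟫ • e) ≤ ⟪x, e⟫} := by
        have := hφ.continuous
        exact isClosed_le (by fun_prop) (by fun_prop)
      exact closure_minimal (fun x hx => ((hgr x hx.2).1 hx.1).le) hc hcl
    have hn : ∀ s : ℝ, 0 ≤ s → ‖s • e‖ = s := fun s hs => by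
      rw [norm_smul, he, mul_one, Real.norm_of_nonneg hs]
    have hpe : p + (r/2) • e ∈ ω := by
      rw [hgr _ (by rw [mem_ball_iff_norm, add_sub_cancel_left, hn _ (by positivity)]; linarith),
        (proj p _).1, (proj p _).2]
      linarith
    obtain ⟨ρ, hρ, h1, h2⟩ := inner _ hpe
    obtain ⟨ε, hε, hε1, hε2⟩ : ∃ ε > 0, ε ≤ ρ ∧ ε ≤ r / 4 :=
      ⟨min ρ (r/4), by positivity, min_le_left _ _, min_le_right _ _⟩
    refine ⟨ball p ε, mem_nhdsWithin_of_mem_nhds (ball_mem_nhds p hε), ?_⟩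
    obtain ⟨C, hC, h3⟩ := h2
    set A := ball p ε ∩ ω with hAdef
    have hAm : MeasurableSet A := measurableSet_ball.inter hωo.measurableSet
    have hAω : ∀ x ∈ A, ∀ s ∈ Icc (0:ℝ) 1, x + s • ((r/2) • e) ∈ ω := by
      rintro x ⟨hx, hxω⟩ s hs
      have hx1 : x ∈ ball p r := ball_subset_ball (by linarith) hx
      have := (hgr x hx1).1 hxω
      rw [smul_smul]
      have hs' : 0 ≤ s * (r/2) := mul_nonneg hs.1 (by positivity)
      have hs2 : s * (r/2) ≤ r / 2 := mul_le_of_le_one_left (by positivity) hs.2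
      rw [hgr, (proj x _).1, (proj x _).2]
      · linarith
      · rw [mem_ball_iff_norm] at hx ⊢
        calc ‖x + (s * (r/2)) • e - p‖ = ‖(x - p) + (s * (r/2)) • e‖ := by congr 1; abel
          _ ≤ _ := norm_add_le _ _
          _ < _ := by rw [hn _ hs']; linarith
    have hAt : volume A ≠ ⊤ := hfin _ inter_subset_right
    have hBt : volume B0 ≠ ⊤ := hfin _ hB0
    refine ⟨2 * volume B0 * ‖(r/2) • e‖ₑ ^ 2 + 2 * C, by finiteness, fun v hv hd => ?_⟩
    have hs := slide hωo v hd A hAm ((r/2) • e) hAω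
    have ht : ∫⁻ x in A, ∫⁻ y in B0, ‖v (x + (r/2) • e) - v y‖ₑ ^ 2 ≤
        ∫⁻ x in ball (p + (r/2) • e) ρ, ∫⁻ y in B0, ‖v x - v y‖ₑ ^ 2 := by
      rw [← lintegral_indicator hAm, ← lintegral_indicator measurableSet_ball,
          ← lintegral_add_right_eq_self ((ball (p + (r/2) • e) ρ).indicator _) ((r/2) • e)]
      refine lintegral_mono fun x => ?_
      by_cases hx : x ∈ A
      · have : x + (r/2) • e ∈ ball (p + (r/2) • e) ρ := by
          have h5 := hx.1
          rw [mem_ball_iff_norm] at h5 ⊢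
          rw [add_sub_add_right_eq_sub]; linarith
        rw [indicator_of_mem hx, indicator_of_mem this]
      · rw [indicator_of_notMem hx]; exact zero_le
    calc ∫⁻ x in A, ∫⁻ y in B0, ‖v x - v y‖ₑ ^ 2
        ≤ ∫⁻ x in A, ∫⁻ y in B0, (2 * ‖v x - v (x + (r/2) • e)‖ₑ ^ 2 +
            2 * ‖v (x + (r/2) • e) - v y‖ₑ ^ 2) :=
          lintegral_mono fun x => lintegral_mono fun y => enorm_sub_sq_le _ _ _
      _ = ∫⁻ x in A, (2 * volume B0 * ‖v (x + (r/2) • e) - v x‖ₑ ^ 2 +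
            2 * ∫⁻ y in B0, ‖v (x + (r/2) • e) - v y‖ₑ ^ 2) := by
          refine lintegral_congr fun x => ?_
          rw [lintegral_add_left measurable_const,
            lintegral_const_mul (f := fun y => ‖v (x + (r/2) • e) - v y‖ₑ ^ 2) _ (by fun_prop),
            ← enorm_neg, neg_sub, setLIntegral_const]
          ring
      _ = 2 * volume B0 * (∫⁻ x in A, ‖v (x + (r/2) • e) - v x‖ₑ ^ 2) +
            2 * ∫⁻ x in A, ∫⁻ y in B0, ‖v (x + (r/2) • e) - v y‖ₑ ^ 2 := by
          rw [lintegral_add_left (by fun_prop), lintegral_const_mul _ (by fun_prop),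
            lintegral_const_mul' _ _ (by simp)]
      _ ≤ _ := by
          rw [add_mul, mul_assoc (2 * volume B0), mul_assoc 2 C]
          gcongr
          exact ht.trans (h3 v hv hd)
  have hcomp : IsCompact (closure ω) := hωb.isCompact_closure
  have hω0 : QRel N ω ω B0 := by
    have := hcomp.induction_on (p := fun s => QRel N ω (s ∩ ω) B0) ⟨0, by simp, by simp⟩
      (fun s t hst h => h.mono (inter_subset_inter_left _ hst) subset_rfl)
      (fun s t h h' => by rw [union_inter_distrib_right]; exact h.union h') key
    rwa [inter_eq_right.2 subset_closure] at this
  exact hω0.trans hω0.symm (measure_ball_pos _ _ hr0).ne' (hfin _ hB0) (hfin _ subset_rfl)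
    (hfin _ subset_rfl)

lemma tail_tendsto (b : ℝ → ℝ≥0∞) (hfin : ∫⁻ t, b t ≠ ⊤) :
    Tendsto (fun t => ∫⁻ r in Ici t, b r) atTop (𝓝 0) := by
  have h := tendsto_measure_iInter_atTop (μ := volume.withDensity b) (s := fun t : ℝ => Ici t)
    (fun t => measurableSet_Ici.nullMeasurableSet) (fun s t hst => Ici_subset_Ici.2 hst)
    ⟨0, by
      rw [withDensity_apply _ measurableSet_Ici]
      exact ((setLIntegral_le_lintegral _ _).trans_lt (lt_top_iff_ne_top.2 hfin)).ne⟩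
  have he : (⋂ t : ℝ, Ici t) = ∅ := by
    ext x
    simp only [mem_iInter, mem_Ici, mem_empty_iff_false, iff_false, not_forall, not_le]
    exact ⟨x + 1, by linarith⟩
  rw [he, measure_empty] at h
  refine h.congr fun t => ?_
  simp only [Function.comp]
  rw [withDensity_apply _ measurableSet_Ici]

lemma finite_sep {X : Type*} [MetricSpace X] (Z : Set X) (hZ : Z.Finite) :
    ∃ δ > 0, ∀ w ∈ Z, ∀ w' ∈ Z, dist w w' < 2 * δ → w = w' := by
  by_cases h : Z.Nontrivial
  · refine ⟨Z.infsep / 2, half_pos (hZ.infsep_pos_iff_nontrivial.2 h), fun w hw w' hw' hd => ?_⟩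
    by_contra hne
    have := Set.infsep_le_dist_of_mem hw hw' hne
    linarith
  · exact ⟨1, one_pos, fun w hw w' hw' _ => not_nontrivial_iff.1 h hw hw'⟩

lemma oneD {N : ℕ} (W : EuclideanSpace ℝ (Fin N) → ℝ≥0∞) (hlsc : LowerSemicontinuous W)
    (hH1 : {z : EuclideanSpace ℝ (Fin N) | W z = 0}.Finite)
    (hH2 : ∃ c : ℝ≥0∞, 0 < c ∧ ∃ R : ℝ, ∀ z : EuclideanSpace ℝ (Fin N), R ≤ ‖z‖ → c ≤ W z)
    (f g : ℝ → EuclideanSpace ℝ (Fin N)) (hg : Measurable g)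
    (hFTC : ∀ s t : ℝ, f t - f s = ∫ r in s..t, g r)
    (h1 : ∫⁻ t, ‖g t‖ₑ ^ 2 ≠ ⊤) (h2 : ∫⁻ t, W (f t) ≠ ⊤) :
    ∃ w, W w = 0 ∧ Tendsto f atTop (𝓝 w) := by
  obtain ⟨c, hc, R, hR⟩ := hH2
  have hinc : ∀ s t : ℝ, ‖f t - f s‖ₑ ^ 2 ≤ ENNReal.ofReal |t - s| * ∫⁻ r in uIoc s t, ‖g r‖ₑ ^ 2 :=
    fun s t => by rw [hFTC]; exact enorm_interval_sq g hg s t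
  have hcont : Continuous f := by
    rw [continuous_iff_continuousAt]
    intro s
    rw [ContinuousAt, tendsto_iff_norm_sub_tendsto_zero]
    have hb : ∀ t, ‖f t - f s‖ ≤ √(|t - s| * (∫⁻ t, ‖g t‖ₑ ^ 2).toReal) := by
      intro t
      apply Real.le_sqrt_of_sq_le
      have h3 := (hinc s t).trans (mul_le_mul_right (setLIntegral_le_lintegral _ _) _)
      have h4 := ENNReal.toReal_mono (by finiteness) h3
      simpa [ENNReal.toReal_mul, ENNReal.toReal_ofReal] using h4
    refine squeeze_zero (fun _ => norm_nonneg _) hb ?_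
    have : Continuous fun t => √(|t - s| * (∫⁻ t, ‖g t‖ₑ ^ 2).toReal) := by fun_prop
    simpa using this.tendsto s
  have hlow : ∀ ε > 0, ∃ δ : ℝ≥0∞, 0 < δ ∧ ∀ z, (∀ w, W w = 0 → ε ≤ dist z w) → δ ≤ W z := by
    intro ε hε
    set K := closedBall (0 : EuclideanSpace ℝ (Fin N)) R ∩ {z | ∀ w, W w = 0 → ε ≤ dist z w} with hK
    have hKc : IsCompact K := by
      refine (isCompact_closedBall _ _).inter_right ?_
      simp only [ofPred_forall]
      exact isClosed_iInter fun w => isClosed_iInter fun _ =>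
        isClosed_le continuous_const (continuous_id.dist continuous_const)
    by_cases hne : K.Nonempty
    · obtain ⟨a, ha, hmin⟩ := (hlsc.lowerSemicontinuousOn K).exists_isMinOn hne hKc
      have hWa : W a ≠ 0 := fun h0 => by
        have := ha.2 a h0
        rw [dist_self] at this; linarith
      refine ⟨min c (W a), lt_min hc (pos_iff_ne_zero.2 hWa), fun z hz => ?_⟩
      by_cases hzR : R ≤ ‖z‖
      · exact (min_le_left _ _).trans (hR z hzR)
      · exact (min_le_right _ _).trans (hmin ⟨by simpa using (not_le.1 hzR).le, hz⟩)
    · refine ⟨c, hc, fun z hz => hR z ?_⟩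
      by_contra hzR
      exact hne ⟨z, by simpa using (not_le.1 hzR).le, hz⟩
  have hnear : ∀ ε > 0, ∀ᶠ t in atTop, ∃ w, W w = 0 ∧ dist (f t) w < ε := by
    intro ε hε
    obtain ⟨δ, hδ, hlo⟩ := hlow (ε / 2) (by positivity)
    have e1 : ∀ᶠ t in atTop, ∫⁻ r in Ici t, ‖g r‖ₑ ^ 2 < ENNReal.ofReal (ε / 2) ^ 2 :=
      (tail_tendsto _ h1).eventually_lt_const (by
        have := ENNReal.ofReal_pos.2 (half_pos hε)
        positivity)
    have e2 : ∀ᶠ t in atTop, ∫⁻ r in Ici t, W (f r) < δ :=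
      (tail_tendsto _ h2).eventually_lt_const hδ
    filter_upwards [e1, e2] with t h3 h4
    by_contra! hcon
    have h5 : ∀ s ∈ Icc t (t + 1), δ ≤ W (f s) := by
      intro s hs
      apply hlo
      intro w hw
      have h6 : ‖f s - f t‖ₑ ^ 2 < ENNReal.ofReal (ε / 2) ^ 2 := by
        refine ((hinc t s).trans ?_).trans_lt h3
        have : ENNReal.ofReal |s - t| ≤ 1 := by
          rw [ENNReal.ofReal_le_one, abs_of_nonneg (by linarith [hs.1])]
          linarith [hs.2]
        refine (mul_le_mul' this (lintegral_mono_set ?_)).trans (one_mul _).le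
        rw [uIoc_of_le hs.1]
        exact fun r hr => hr.1.le
      have h7 : ‖f s - f t‖ < ε / 2 := by
        have h8 : ‖f s - f t‖ₑ < ENNReal.ofReal (ε / 2) := lt_of_pow_lt_pow_left' 2 h6
        rw [← ofReal_norm, ENNReal.ofReal_lt_ofReal_iff (by positivity)] at h8
        exact h8
      have h9 := hcon w hw
      have h10 := dist_triangle (f t) (f s) w
      rw [dist_comm (f t) (f s), dist_eq_norm (f s) (f t)] at h10
      linarith
    have : δ ≤ ∫⁻ r in Ici t, W (f r) := calc
      δ = ∫⁻ r in Icc t (t + 1), δ := by simp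
      _ ≤ ∫⁻ r in Icc t (t + 1), W (f r) := setLIntegral_mono' measurableSet_Icc h5
      _ ≤ _ := lintegral_mono_set fun r hr => hr.1
    exact absurd h4 (not_lt.2 this)
  obtain ⟨δ, hδ, hsep⟩ := finite_sep _ hH1
  obtain ⟨T, hT⟩ := eventually_atTop.1 (hnear δ hδ)
  obtain ⟨w, hw, hwT⟩ := hT T le_rfl
  have hin : ∀ t ≥ T, dist (f t) w < δ := by
    have hpre : IsPreconnected (f '' Ici T) := isPreconnected_Ici.image f hcont.continuousOn
    have hsub := IsPreconnected.subset_left_of_subset_union (s := f '' Ici T) (u := ball w δ)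
      (v := ⋃ w' ∈ {w' | W w' = 0 ∧ w' ≠ w}, ball w' δ) isOpen_ball
      (isOpen_biUnion fun _ _ => isOpen_ball) ?_ ?_ ⟨f T, mem_image_of_mem f self_mem_Ici, hwT⟩ hpre
    · exact fun t ht => hsub (mem_image_of_mem f ht)
    · simp only [disjoint_iUnion_right]
      rintro w' ⟨hw', hne⟩
      rw [Set.disjoint_left]
      intro z hz hz'
      apply hne
      refine hsep w' hw' w hw ?_
      have := dist_triangle_left w' w z
      rw [mem_ball] at hz hz'
      linarith
    · rintro _ ⟨t, ht, rfl⟩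
      obtain ⟨w', hw', hd⟩ := hT t ht
      by_cases h : w' = w
      · left; rw [← h]; exact hd
      · right; exact mem_biUnion (show w' ∈ {w' | W w' = 0 ∧ w' ≠ w} from ⟨hw', h⟩) hd
  refine ⟨w, hw, Metric.tendsto_nhds.2 fun ε hε => ?_⟩
  filter_upwards [hnear (min ε δ) (lt_min hε hδ), eventually_ge_atTop T] with t ⟨w', hw', hd⟩ ht
  have : w' = w := by
    refine hsep w' hw' w hw ?_
    have := dist_triangle_left w' w (f t)
    have := hin t ht
    have := min_le_right ε δ
    linarith
  rw [← this]
  exact hd.trans_le (min_le_left _ _)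

lemma half {m N : ℕ} (ω : Set (EuclideanSpace ℝ (Fin m)))
    (hωo : IsOpen ω) (hne : ω.Nonempty) (hωb : Bornology.IsBounded ω) (hP : QRel N ω ω ω)
    (W : EuclideanSpace ℝ (Fin N) → ℝ≥0∞) (hlsc : LowerSemicontinuous W)
    (hH1 : {z : EuclideanSpace ℝ (Fin N) | W z = 0}.Finite)
    (hH2 : ∃ c : ℝ≥0∞, 0 < c ∧ ∃ R : ℝ, ∀ z : EuclideanSpace ℝ (Fin N), R ≤ ‖z‖ → c ≤ W z)
    (u g : ℝ × EuclideanSpace ℝ (Fin m) → EuclideanSpace ℝ (Fin N))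
    (hu : Measurable u) (hg : Measurable g)
    (hFTC : ∀ x' ∈ ω, ∀ s t : ℝ, u (t, x') - u (s, x') = ∫ r in s..t, g (r, x'))
    (hslice : ∀ t : ℝ, DifferentiableOn ℝ (fun y => u (t, y)) ω)
    (D : ℝ × EuclideanSpace ℝ (Fin m) → ℝ≥0∞) (hD : Measurable D)
    (hDeq : ∀ t, ∀ y ∈ ω, D (t, y) = ‖fderiv ℝ (fun y => u (t, y)) y‖ₑ ^ 2)
    (hE : ∫⁻ t, ∫⁻ x in ω, (‖g (t, x)‖ₑ ^ 2 + D (t, x) + W (u (t, x))) ≠ ⊤) :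
    ∃ up : EuclideanSpace ℝ (Fin N), W up = 0 ∧
      Tendsto (fun t => ∫⁻ x' in ω, ‖u (t, x') - up‖ₑ ^ 2) atTop (nhds 0) ∧
      (∀ᵐ x' ∂(volume.restrict ω), Tendsto (fun t => u (t, x')) atTop (nhds up)) := by
  have hWm : Measurable W := hlsc.measurable
  set μ := (volume.restrict ω : Measure (EuclideanSpace ℝ (Fin m))) with hμ
  have : IsFiniteMeasure μ := ⟨by rw [hμ, Measure.restrict_apply_univ]; exact hωb.measure_lt_top⟩
  have hμ0 : μ ≠ 0 := by
    rw [hμ, Ne, Measure.restrict_eq_zero]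
    exact (hωo.measure_pos _ hne).ne'
  have : (ae μ).NeBot := ae_neBot.2 hμ0
  have hmemω : ∀ᵐ x ∂μ, x ∈ ω := ae_restrict_mem hωo.measurableSet
  set H : ℝ × EuclideanSpace ℝ (Fin m) → ℝ≥0∞ := fun p => ‖g p‖ₑ ^ 2 + D p + W (u p) with hH
  have hHm : Measurable H := by
    have := hWm.comp hu
    exact ((hg.enorm.pow_const 2).add hD).add this
  change ∫⁻ t, ∫⁻ x, H (t, x) ∂μ ≠ ⊤ at hE
  set b : ℝ → ℝ≥0∞ := fun t => ∫⁻ x, H (t, x) ∂μ with hb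
  have hbm : Measurable b := hHm.lintegral_prod_right'
  have hlim : ∀ᵐ x ∂μ, ∃ w, W w = 0 ∧ Tendsto (fun t => u (t, x)) atTop (𝓝 w) := by
    have hsw : ∫⁻ x, (∫⁻ t, H (t, x)) ∂μ ≠ ⊤ := by
      rw [lintegral_lintegral_swap (f := fun x t => H (t, x))
        (hHm.comp measurable_swap).aemeasurable]
      exact hE
    have hm2 : Measurable fun x => ∫⁻ t, H (t, x) := hHm.lintegral_prod_left'
    filter_upwards [ae_lt_top hm2 hsw, hmemω] with x hx hxω
    refine oneD W hlsc hH1 hH2 (fun t => u (t, x)) (fun t => g (t, x)) (by fun_prop)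
      (hFTC x hxω) ?_ ?_
    · exact ((lintegral_mono fun t => (le_self_add.trans le_self_add :
        ‖g (t, x)‖ₑ ^ 2 ≤ H (t, x))).trans_lt hx).ne
    · exact ((lintegral_mono fun t => (le_add_self :
        W (u (t, x)) ≤ H (t, x))).trans_lt hx).ne
  obtain ⟨C, hC, hPC⟩ := hP
  have htail : Tendsto (fun t => ∫⁻ r in Ici t, b r) atTop (𝓝 0) := tail_tendsto b hE
  have hgood : ∀ t, ∃ s ∈ Icc t (t + 1), b s ≤ ∫⁻ r in Ici t, b r := by
    intro t
    obtain ⟨s, hs, hle⟩ := exists_le_setLAverage (μ := volume) (s := Icc t (t + 1)) (f := b)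
      (by simp) (by simp) hbm.aemeasurable
    refine ⟨s, hs, hle.trans ?_⟩
    rw [setLAverage_eq]
    simp only [Real.volume_Icc, add_sub_cancel_left, ENNReal.ofReal_one, div_one]
    exact lintegral_mono_set fun r hr => hr.1
  choose σ hσ hσb using hgood
  have hdiffm : ∀ t, Measurable fun p : EuclideanSpace ℝ (Fin m) × EuclideanSpace ℝ (Fin m) =>
      ‖u (t, p.1) - u (t, p.2)‖ₑ ^ 2 := fun t => by fun_prop
  have hfatou : ∀ τ : ℕ → ℝ, Tendsto τ atTop atTop →
      ∀ᵐ x ∂μ, liminf (fun n => ∫⁻ y, ‖u (σ (τ n), x) - u (σ (τ n), y)‖ₑ ^ 2 ∂μ) atTop = 0 := by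
    intro τ hτ
    have hPhim : ∀ n, Measurable fun x => ∫⁻ y, ‖u (σ (τ n), x) - u (σ (τ n), y)‖ₑ ^ 2 ∂μ :=
      fun n => (hdiffm (σ (τ n))).lintegral_prod_right'
    have hle : ∀ n, ∫⁻ x, ∫⁻ y, ‖u (σ (τ n), x) - u (σ (τ n), y)‖ₑ ^ 2 ∂μ ∂μ ≤
        C * ∫⁻ r in Ici (τ n), b r := by
      intro n
      refine (hPC (fun y => u (σ (τ n), y)) (by fun_prop) (hslice _)).trans ?_
      refine mul_le_mul_right (le_trans ?_ (hσb (τ n))) _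
      refine setLIntegral_mono' hωo.measurableSet fun y hy => ?_
      rw [← hDeq _ y hy]
      exact (le_add_self.trans le_self_add : D (σ (τ n), y) ≤ H (σ (τ n), y))
    have ht0 : Tendsto (fun n => C * ∫⁻ r in Ici (τ n), b r) atTop (𝓝 0) := by
      have := ENNReal.Tendsto.const_mul (htail.comp hτ) (Or.inr hC)
      simpa using this
    have ht1 : Tendsto (fun n => ∫⁻ x, ∫⁻ y, ‖u (σ (τ n), x) - u (σ (τ n), y)‖ₑ ^ 2 ∂μ ∂μ) atTop (𝓝 0) :=
      tendsto_of_tendsto_of_tendsto_of_le_of_le tendsto_const_nhds ht0 (fun _ => zero_le) hle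
    have hF := lintegral_liminf_le (μ := μ) (u := atTop) hPhim
    rw [ht1.liminf_eq, nonpos_iff_eq_zero, lintegral_eq_zero_iff (Measurable.liminf hPhim)] at hF
    exact hF
  have hσt : ∀ τ : ℕ → ℝ, Tendsto τ atTop atTop → Tendsto (fun n => σ (τ n)) atTop atTop :=
    fun τ hτ => tendsto_atTop_mono (fun n => (hσ (τ n)).1) hτ
  obtain ⟨up, hup, hae⟩ : ∃ up, W up = 0 ∧ ∀ᵐ x ∂μ, Tendsto (fun t => u (t, x)) atTop (𝓝 up) := by
    have hτ : Tendsto (fun n : ℕ => (n : ℝ)) atTop atTop := tendsto_natCast_atTop_atTop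
    obtain ⟨x0, hx0, w, hw, hxw⟩ := ((hfatou _ hτ).and hlim).exists
    refine ⟨w, hw, ?_⟩
    have hF := lintegral_liminf_le (μ := μ) (u := atTop)
      (f := fun (n : ℕ) y => ‖u (σ n, x0) - u (σ n, y)‖ₑ ^ 2) (fun n => by fun_prop)
    rw [hx0, nonpos_iff_eq_zero, lintegral_eq_zero_iff (Measurable.liminf fun n => by fun_prop)] at hF
    filter_upwards [hF, hlim] with y hy ⟨w', _, hyw⟩
    have h1 : Tendsto (fun n : ℕ => ‖u (σ n, x0) - u (σ n, y)‖ₑ ^ 2) atTop (𝓝 (‖w - w'‖ₑ ^ 2)) :=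
      ENNReal.Tendsto.pow ((hxw.comp (hσt _ hτ)).sub (hyw.comp (hσt _ hτ))).enorm
    have h2 : ‖w - w'‖ₑ ^ 2 = 0 := by
      rw [← h1.liminf_eq]; exact hy
    have : w = w' := by simpa [sub_eq_zero] using h2
    rw [this]; exact hyw
  refine ⟨up, hup, ?_, hae⟩
  rw [ENNReal.tendsto_nhds_zero]
  intro ε hε
  by_contra hcon
  obtain ⟨τ, hτ, hbad⟩ := exists_seq_forall_of_frequently (not_eventually.1 hcon)
  obtain ⟨y0, hy0, hy0t⟩ := ((hfatou τ hτ).and hae).exists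
  have hε2 : 0 < ε / 2 := ENNReal.half_pos hε.ne'
  have hfr : ∃ᶠ n in atTop, ∫⁻ y, ‖u (σ (τ n), y0) - u (σ (τ n), y)‖ₑ ^ 2 ∂μ < ε / 2 / 4 :=
    frequently_lt_of_liminf_lt (by isBoundedDefault) (by
      rw [hy0]; exact ENNReal.div_pos hε2.ne' (by simp))
  have hrest : Tendsto (fun n => 4 * μ univ * ‖u (σ (τ n), y0) - up‖ₑ ^ 2 +
      2 * ∫⁻ r in Ici (τ n), b r) atTop (𝓝 0) := by
    have h1 : Tendsto (fun n => ‖u (σ (τ n), y0) - up‖ₑ ^ 2) atTop (𝓝 0) := by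
      have := ENNReal.Tendsto.pow (n := 2)
        ((hy0t.comp (hσt τ hτ)).sub (tendsto_const_nhds (x := up))).enorm
      simpa using this
    have h2 := ENNReal.Tendsto.const_mul (a := 4 * μ univ) h1
      (Or.inr (by finiteness))
    have h3 := ENNReal.Tendsto.const_mul (a := 2) (htail.comp hτ) (Or.inr (by simp))
    simpa using h2.add h3
  obtain ⟨n, hn1, hn2⟩ := (hfr.and_eventually (hrest.eventually_lt_const hε2)).exists
  apply hbad n
  set t := τ n
  set s := σ t
  have hmv : ∫⁻ x, ‖u (t, x) - u (s, x)‖ₑ ^ 2 ∂μ ≤ ∫⁻ r in Ici t, b r := by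
    calc ∫⁻ x, ‖u (t, x) - u (s, x)‖ₑ ^ 2 ∂μ
        ≤ ∫⁻ x, (∫⁻ r in Ici t, H (r, x)) ∂μ := by
          refine lintegral_mono_ae ?_
          filter_upwards [hmemω] with x hx
          rw [hFTC x hx]
          refine (enorm_interval_sq _ (by fun_prop) s t).trans ?_
          have hs := hσ t
          have h1 : ENNReal.ofReal |t - s| ≤ 1 := by
            rw [ENNReal.ofReal_le_one, abs_sub_comm, abs_of_nonneg (by linarith [hs.1])]
            linarith [hs.2]
          refine (mul_le_mul' h1 (lintegral_mono_set (t := Ici t) ?_)).trans ?_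
          · rw [uIoc_comm, uIoc_of_le hs.1]
            exact fun r hr => hr.1.le
          · rw [one_mul]
            exact lintegral_mono fun r => (le_self_add.trans le_self_add :
              ‖g (r, x)‖ₑ ^ 2 ≤ H (r, x))
      _ = _ := lintegral_lintegral_swap (f := fun x t => H (t, x))
        (hHm.comp measurable_swap).aemeasurable
  have has : ∫⁻ x, ‖u (s, x) - up‖ₑ ^ 2 ∂μ ≤
      2 * (∫⁻ x, ‖u (s, y0) - u (s, x)‖ₑ ^ 2 ∂μ) + 2 * μ univ * ‖u (s, y0) - up‖ₑ ^ 2 := by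
    calc _ ≤ ∫⁻ x, (2 * ‖u (s, x) - u (s, y0)‖ₑ ^ 2 + 2 * ‖u (s, y0) - up‖ₑ ^ 2) ∂μ :=
          lintegral_mono fun x => enorm_sub_sq_le _ _ _
      _ = _ := by
          rw [lintegral_add_right _ measurable_const, lintegral_const_mul' _ _ (by simp),
            lintegral_const]
          simp_rw [← enorm_neg (u (s, _) - u (s, y0)), neg_sub]
          ring
  calc ∫⁻ x, ‖u (t, x) - up‖ₑ ^ 2 ∂μ
      ≤ ∫⁻ x, (2 * ‖u (t, x) - u (s, x)‖ₑ ^ 2 + 2 * ‖u (s, x) - up‖ₑ ^ 2) ∂μ :=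
        lintegral_mono fun x => enorm_sub_sq_le _ _ _
    _ = 2 * (∫⁻ x, ‖u (t, x) - u (s, x)‖ₑ ^ 2 ∂μ) + 2 * ∫⁻ x, ‖u (s, x) - up‖ₑ ^ 2 ∂μ := by
        rw [lintegral_add_right _ (by fun_prop), lintegral_const_mul' _ _ (by simp),
          lintegral_const_mul' _ _ (by simp)]
    _ ≤ 2 * (∫⁻ r in Ici t, b r) + 2 * (2 * (∫⁻ x, ‖u (s, y0) - u (s, x)‖ₑ ^ 2 ∂μ) +
          2 * μ univ * ‖u (s, y0) - up‖ₑ ^ 2) := by gcongr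
    _ = 4 * (∫⁻ x, ‖u (s, y0) - u (s, x)‖ₑ ^ 2 ∂μ) + (4 * μ univ * ‖u (s, y0) - up‖ₑ ^ 2 +
          2 * ∫⁻ r in Ici t, b r) := by ring
    _ ≤ 4 * (ε / 2 / 4) + ε / 2 := by gcongr
    _ = ε := by
        rw [ENNReal.mul_div_cancel (by simp) (by simp), ENNReal.add_halves]

lemma grad_meas {m N : ℕ} (ω : Set (EuclideanSpace ℝ (Fin m))) (hωo : IsOpen ω)
    (u : ℝ × EuclideanSpace ℝ (Fin m) → EuclideanSpace ℝ (Fin N)) (hu : Measurable u)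
    (hslice : ∀ t : ℝ, DifferentiableOn ℝ (fun y => u (t, y)) ω) :
    ∃ D : ℝ × EuclideanSpace ℝ (Fin m) → ℝ≥0∞, Measurable D ∧
      ∀ t, ∀ y ∈ ω, D (t, y) = ‖fderiv ℝ (fun y => u (t, y)) y‖ₑ ^ 2 := by
  classical
  set S : Set (ℝ × EuclideanSpace ℝ (Fin m)) := univ ×ˢ ω with hS
  have hSm : MeasurableSet S := MeasurableSet.univ.prod hωo.measurableSet
  have hdir : ∀ e : EuclideanSpace ℝ (Fin m), Measurable (S.indicator
      fun p => fderiv ℝ (fun y => u (p.1, y)) p.2 e) := by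
    intro e
    refine measurable_of_tendsto_metrizable (f := fun (n : ℕ) => S.indicator
      fun p => ((n : ℝ) + 1) • (u (p.1, p.2 + ((n : ℝ) + 1)⁻¹ • e) - u p))
      (fun n => ?_) ?_
    · exact Measurable.indicator (by fun_prop) hSm
    · rw [tendsto_pi_nhds]
      intro p
      by_cases hp : p ∈ S
      · simp only [indicator_of_mem hp]
        have hd : HasFDerivAt (fun y => u (p.1, y)) (fderiv ℝ (fun y => u (p.1, y)) p.2) p.2 :=
          (((hslice p.1) p.2 hp.2).differentiableAt (hωo.mem_nhds hp.2)).hasFDerivAt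
        have hc : Tendsto (fun n : ℕ => ‖(n : ℝ) + 1‖) atTop atTop :=
          tendsto_norm_atTop_atTop.comp
            (tendsto_atTop_add_const_right _ _ tendsto_natCast_atTop_atTop)
        exact hd.lim e hc
      · simp only [indicator_of_notMem hp]; exact tendsto_const_nhds
  let bs := EuclideanSpace.basisFun (Fin m) ℝ
  let G : ℝ × EuclideanSpace ℝ (Fin m) → EuclideanSpace ℝ (Fin m) →L[ℝ] EuclideanSpace ℝ (Fin N) :=
    fun p => ∑ i, ContinuousLinearMap.smulRightL ℝ _ _ (EuclideanSpace.proj i)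
      (S.indicator (fun p => fderiv ℝ (fun y => u (p.1, y)) p.2 (bs i)) p)
  have hG : Measurable G := by
    refine Finset.measurable_sum _ fun i _ => ?_
    exact (ContinuousLinearMap.continuous _).measurable.comp (hdir (bs i))
  refine ⟨fun p => ‖G p‖ₑ ^ 2, hG.enorm.pow_const 2, fun t y hy => ?_⟩
  have hp : (t, y) ∈ S := ⟨mem_univ _, hy⟩
  have : G (t, y) = fderiv ℝ (fun y => u (t, y)) y := by
    ext1 x
    simp only [G, indicator_of_mem hp]
    conv_rhs => rw [← bs.sum_repr x, map_sum]
    simp [bs]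
  simp only [this]

/-- **Theorem 1, pointwise part.** Under the hypotheses of the main theorem,
`u(x₁, x') → u^±` for a.e. `x' ∈ ω` as `x₁ → ±∞`, where `u^±` are the same wells as in the
`L²` convergence. -/
theorem main_ae_convergence {m N : ℕ} (ω : Set (EuclideanSpace ℝ (Fin m)))
    (hωo : IsOpen ω) (hωc : IsConnected ω) (hωb : Bornology.IsBounded ω)
    (hωl : LipschitzBoundary ω)
    (W : EuclideanSpace ℝ (Fin N) → ℝ≥0∞) (hlsc : LowerSemicontinuous W)
    (hH1 : {z : EuclideanSpace ℝ (Fin N) | W z = 0}.Finite)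
    (hH2 : ∃ c : ℝ≥0∞, 0 < c ∧ ∃ R : ℝ, ∀ z : EuclideanSpace ℝ (Fin N), R ≤ ‖z‖ → c ≤ W z)
    (u g : ℝ × EuclideanSpace ℝ (Fin m) → EuclideanSpace ℝ (Fin N))
    (hu : Measurable u) (hg : Measurable g)
    (hFTC : ∀ x' ∈ ω, ∀ s t : ℝ, u (t, x') - u (s, x') = ∫ r in s..t, g (r, x'))
    (hslice : ∀ t : ℝ, MemH1 ω (fun y => u (t, y)))
    (hE : (∫⁻ p in (Set.univ ×ˢ ω : Set (ℝ × EuclideanSpace ℝ (Fin m))),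
        ((‖g p‖₊ : ℝ≥0∞) ^ 2 +
          (‖fderivWithin ℝ (fun y => u (p.1, y)) ω p.2‖₊ : ℝ≥0∞) ^ 2 + W (u p))) < ⊤) :
    ∃ um up : EuclideanSpace ℝ (Fin N), W um = 0 ∧ W up = 0 ∧
      Tendsto (fun t => ∫⁻ x' in ω, (‖u (t, x') - up‖₊ : ℝ≥0∞) ^ 2) atTop (nhds 0) ∧
      Tendsto (fun t => ∫⁻ x' in ω, (‖u (t, x') - um‖₊ : ℝ≥0∞) ^ 2) atBot (nhds 0) ∧
      (∀ᵐ x' ∂(volume.restrict ω), Tendsto (fun t => u (t, x')) atTop (nhds up)) ∧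
      (∀ᵐ x' ∂(volume.restrict ω), Tendsto (fun t => u (t, x')) atBot (nhds um)) := by
  have hP := poincare N ω hωo hωc hωb hωl
  have hsl : ∀ t : ℝ, DifferentiableOn ℝ (fun y => u (t, y)) ω := fun t => (hslice t).1
  obtain ⟨D, hD, hDeq⟩ := grad_meas ω hωo u hu hsl
  have hHm : Measurable fun p => ‖g p‖ₑ ^ 2 + D p + W (u p) := by
    have := hlsc.measurable.comp hu
    exact ((hg.enorm.pow_const 2).add hD).add this
  have hE' : ∫⁻ t, ∫⁻ x in ω, (‖g (t, x)‖ₑ ^ 2 + D (t, x) + W (u (t, x))) ≠ ⊤ := by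
    refine ((le_of_eq ?_).trans_lt hE).ne
    rw [Measure.volume_eq_prod, ← Measure.prod_restrict, Measure.restrict_univ]
    rw [← lintegral_prod (fun p => ‖g p‖ₑ ^ 2 + D p + W (u p)) hHm.aemeasurable]
    have hω : ∀ᵐ p ∂((volume : Measure ℝ).prod (volume.restrict ω)), p.2 ∈ ω :=
      Measure.quasiMeasurePreserving_snd.ae (ae_restrict_mem hωo.measurableSet)
    refine lintegral_congr_ae ?_
    filter_upwards [hω] with p hp
    rw [fderivWithin_of_isOpen hωo hp]
    rw [show D p = D (p.1, p.2) from rfl, hDeq p.1 p.2 hp]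
    rfl
  obtain ⟨up, h1, h2, h3⟩ := half ω hωo hωc.nonempty hωb hP W hlsc hH1 hH2 u g hu hg hFTC hsl D hD
    hDeq hE'
  obtain ⟨um, h4, h5, h6⟩ := half ω hωo hωc.nonempty hωb hP W hlsc hH1 hH2
    (fun p => u (-p.1, p.2)) (fun p => -g (-p.1, p.2)) (by fun_prop) (by fun_prop)
    (fun x hx s t => by
      rw [intervalIntegral.integral_neg, intervalIntegral.integral_comp_neg (fun r => g (r, x)),
        intervalIntegral.integral_symm, neg_neg]
      exact hFTC x hx (-s) (-t))
    (fun t => hsl (-t)) (fun p => D (-p.1, p.2)) (by fun_prop) (fun t y hy => hDeq (-t) y hy)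
    (by
      simp only [enorm_neg]
      rw [lintegral_neg_eq_self (fun t => ∫⁻ x in ω, (‖g (t, x)‖ₑ ^ 2 + D (t, x) + W (u (t, x))))]
      exact hE')
  refine ⟨um, up, h4, h1, h2, ?_, h3, ?_⟩
  · refine (h5.comp tendsto_neg_atBot_atTop).congr fun t => ?_
    simp only [Function.comp, neg_neg]
    rfl
  · filter_upwards [h6] with x hx
    refine (hx.comp tendsto_neg_atBot_atTop).congr fun t => ?_
    simp only [Function.comp, neg_neg]
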